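/- arXiv:1304.2488 — 7 statements merged into one kernel-verified Lean document; each statement's English description precedes it below -/
import Mathlib

section
/- For all real x ≥ 0, the Gaussian Q-function satisfies the lower bound Q(x) ≥ (1/2)·exp(−x²/2 − √(2/π)·x). -/
open Real MeasureTheory

/-- The Gaussian Q-function: tail probability of a standard normal. -/
noncomputable def gaussQ (x : ℝ) : ℝ :=
  (1 / Real.sqrt (2 * Real.pi)) * ∫ u in Set.Ioi x, Real.exp (-u ^ 2 / 2)

/-- The standard normal density. -/
noncomputable def gaussPhi (x : ℝ) : ℝ :=
  Real.exp (-x ^ 2 / 2) / Real.sqrt (2 * Real.pi)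

lemma exp_int : Integrable (fun t : ℝ => Real.exp (-t^2/2)) := by
  have := integrable_exp_neg_mul_sq (b := 1/2) (by norm_num)
  convert this using 3; ring

lemma mul_exp_int : Integrable (fun t : ℝ => t * Real.exp (-t^2/2)) := by
  have := integrable_mul_exp_neg_mul_sq (b := 1/2) (by norm_num)
  convert this using 4; ring

lemma int0 : ∫ t in Set.Ioi (0:ℝ), Real.exp (-t^2/2) = Real.sqrt (2 * Real.pi) / 2 := by
  have := integral_gaussian_Ioi (1/2)
  rw [show 2 * Real.pi = Real.pi / (1/2) by ring, ← this]
  congr 1; ext t; congr 1; ring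

lemma int1 : ∫ t in Set.Ioi (0:ℝ), t * Real.exp (-t^2/2) = 1 := by
  have hd : ∀ t ∈ Set.Ici (0:ℝ), HasDerivAt (fun t : ℝ => -Real.exp (-t^2/2)) (t * Real.exp (-t^2/2)) t := by
    intro t _
    have h2 : HasDerivAt (fun t : ℝ => -t^2/2) (-t) t := by
      have := ((hasDerivAt_pow 2 t).neg.div_const 2)
      refine this.congr_deriv ?_
      norm_num
      try ring
    refine h2.exp.neg.congr_deriv ?_
    ring
  have hl : Filter.Tendsto (fun t : ℝ => -Real.exp (-t^2/2)) Filter.atTop (nhds (-0)) := by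
    apply Filter.Tendsto.neg
    apply Real.tendsto_exp_atBot.comp
    have : Filter.Tendsto (fun t : ℝ => t^2/2) Filter.atTop Filter.atTop :=
      (Filter.tendsto_pow_atTop (by norm_num)).atTop_div_const (by norm_num)
    have := Filter.tendsto_neg_atTop_atBot.comp this
    refine this.congr fun t => ?_
    simp; ring
  rw [integral_Ioi_of_hasDerivAt_of_tendsto' hd mul_exp_int.integrableOn hl]
  simp

theorem gaussQ_lower_bound (x : ℝ) (hx : 0 ≤ x) :
    gaussQ x ≥ (1 / 2) * Real.exp (-x ^ 2 / 2 - Real.sqrt (2 / Real.pi) * x) := by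
  unfold gaussQ
  set m := Real.sqrt (2 / Real.pi) with hm
  have hs : 0 < Real.sqrt (2 * Real.pi) := by positivity
  have hms : m * Real.sqrt (2 * Real.pi) = 2 := by
    rw [hm, ← Real.sqrt_mul (by positivity), show 2 / Real.pi * (2 * Real.pi) = 2^2 by
      field_simp; try norm_num]
    exact Real.sqrt_sq (by norm_num)
  have hsub : ∫ u in Set.Ioi x, Real.exp (-u ^ 2 / 2)
      = ∫ t in Set.Ioi (0:ℝ), Real.exp (-(t + x) ^ 2 / 2) := by
    have := (measurePreserving_add_right volume x).setIntegral_preimage_emb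
      (measurableEmbedding_addRight x) (fun u : ℝ => Real.exp (-u ^ 2 / 2)) (Set.Ioi x)
    rw [← this]
    simp
  have hC := Real.exp_pos (-x ^ 2 / 2 - m * x)
  set C := Real.exp (-x ^ 2 / 2 - m * x) with hCd
  have hmono : ∫ t in Set.Ioi (0:ℝ), (C * (1 + x * m) * Real.exp (-t^2/2)
        - C * x * (t * Real.exp (-t^2/2)))
      ≤ ∫ t in Set.Ioi (0:ℝ), Real.exp (-(t + x) ^ 2 / 2) := by
    apply setIntegral_mono
    · exact ((exp_int.const_mul _).sub (mul_exp_int.const_mul _)).integrableOn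
    · exact (exp_int.comp_add_right x).integrableOn
    · intro t
      have h := Real.add_one_le_exp (-(x * (t - m)))
      have e : Real.exp (-(t + x) ^ 2 / 2)
          = C * Real.exp (-t^2/2) * Real.exp (-(x * (t - m))) := by
        rw [hCd, ← Real.exp_add, ← Real.exp_add]; congr 1; ring
      have := mul_le_mul_of_nonneg_left h (mul_pos hC (Real.exp_pos (-t^2/2))).le
      simp only
      rw [e]
      linarith
  rw [integral_sub (exp_int.const_mul _).integrableOn (mul_exp_int.const_mul _).integrableOn,
    integral_const_mul, integral_const_mul, int0, int1] at hmono
  rw [hsub, ge_iff_le, one_div_mul_eq_div (Real.sqrt (2 * Real.pi)), le_div_iff₀ hs]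
  refine le_trans (le_of_eq ?_) hmono
  linear_combination (-C * x / 2) * hms
end

section
/- For all real x ≥ 0, the Gaussian Q-function satisfies the upper bound Q(x) ≤ (1/2)·exp(−x²/π − √(2/π)·x). -/
open Real MeasureTheory

lemma shape_aux (c : ℝ) (hc0 : 0 < c) (hc : 2 * c < 1) {t u : ℝ} (ht : 0 ≤ t) (htu : t ≤ u)
    (hu : 0 ≤ u - c * u ^ 2 - Real.log (1 + u)) : 0 ≤ t - c * t ^ 2 - Real.log (1 + t) := by
  set h : ℝ → ℝ := fun y => y - c * y ^ 2 - Real.log (1 + y) with hh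
  have hd : ∀ y : ℝ, 0 ≤ y → HasDerivAt h (y * (1 - 2 * c - 2 * c * y) / (1 + y)) y := by
    intro y hy
    have h1 : (1 + y) ≠ 0 := by positivity
    have := (((hasDerivAt_id' y).sub (((hasDerivAt_id' y).pow 2).const_mul c)).sub
      (((hasDerivAt_id' y).const_add 1).log h1))
    refine this.congr_deriv ?_
    field_simp
    push_cast
    ring
  set m : ℝ := (1 - 2 * c) / (2 * c) with hm
  have hm0 : 0 ≤ m := div_nonneg (by linarith) (by linarith)
  have hmc : m * (2 * c) = 1 - 2 * c := by rw [hm]; field_simp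
  have mono : MonotoneOn h (Set.Icc 0 m) := by
    apply monotoneOn_of_hasDerivWithinAt_nonneg (convex_Icc _ _)
      (fun y hy => (hd y hy.1).continuousAt.continuousWithinAt)
      (f' := fun y => (y * (1 - 2 * c - 2 * c * y) / (1 + y)))
    · intro y hy
      rw [interior_Icc] at hy
      exact (hd y hy.1.le).hasDerivWithinAt
    · intro y hy
      rw [interior_Icc] at hy
      have : 0 ≤ 1 - 2 * c - 2 * c * y := by nlinarith [hy.2]
      have := hy.1
      positivity
  have anti : AntitoneOn h (Set.Ici m) := by
    apply antitoneOn_of_hasDerivWithinAt_nonpos (convex_Ici _)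
      (fun y hy => (hd y (hm0.trans hy)).continuousAt.continuousWithinAt)
      (f' := fun y => (y * (1 - 2 * c - 2 * c * y) / (1 + y)))
    · intro y hy
      rw [interior_Ici] at hy
      exact (hd y (hm0.trans hy.le)).hasDerivWithinAt
    · intro y hy
      rw [interior_Ici] at hy
      have hy' : m < y := hy
      have : 1 - 2 * c - 2 * c * y ≤ 0 := by nlinarith
      have h0 : 0 ≤ y := by linarith
      exact div_nonpos_of_nonpos_of_nonneg (mul_nonpos_of_nonneg_of_nonpos h0 this) (by linarith)
  change 0 ≤ h t
  rcases le_total t m with h1 | h1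
  · have := mono ⟨le_rfl, hm0⟩ ⟨ht, h1⟩ ht
    simpa [hh] using this
  · exact le_trans hu (anti h1 (h1.trans htu : m ≤ u) htu)

theorem gaussQ_upper_bound (x : ℝ) (hx : 0 ≤ x) :
    gaussQ x ≤ (1 / 2) * Real.exp (-x ^ 2 / Real.pi - Real.sqrt (2 / Real.pi) * x) := by
  have hpi := Real.pi_pos
  set s : ℝ := Real.sqrt (2 / Real.pi) with hs
  have hs0 : 0 < s := Real.sqrt_pos.2 (by positivity)
  have hs2 : s ^ 2 = 2 / π := Real.sq_sqrt (by positivity)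
  have hs3 : 1 / Real.sqrt (2 * π) = s / 2 := by
    have h1 : Real.sqrt (2 * π) * s = 2 := by
      rw [hs, ← Real.sqrt_mul (by positivity)]
      rw [show 2 * π * (2 / π) = 2 ^ 2 by field_simp]
      exact Real.sqrt_sq (by norm_num)
    have : 0 < Real.sqrt (2 * π) := by positivity
    field_simp
    linarith
  set f : ℝ → ℝ := fun u => Real.exp (-u ^ 2 / 2) with hf
  have hfc : Continuous f := by fun_prop
  have hfe : f = fun u => Real.exp (-(1/2) * u ^ 2) := by
    ext u; simp only [hf]; ring_nf
  have hfi : Integrable f := by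
    rw [hfe]; exact integrable_exp_neg_mul_sq (by norm_num)
  have hC : s / 2 * ∫ u in Set.Ioi 0, f u = 1 / 2 := by
    rw [hfe, integral_gaussian_Ioi, ← hs3, show π / (1/2) = 2 * π by ring]
    have : 0 < Real.sqrt (2 * π) := by positivity
    field_simp
  set E : ℝ → ℝ := fun y => Real.exp (-y ^ 2 / π - s * y) with hE
  set g : ℝ → ℝ := fun y => 1 / 2 * E y - (1 / 2 - s / 2 * ∫ u in (0:ℝ)..y, f u) with hg
  have hQ : gaussQ x = 1 / 2 - s / 2 * ∫ u in (0:ℝ)..x, f u := by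
    have := intervalIntegral.integral_Ioi_sub_Ioi (f := f) (μ := volume) (a := 0) (b := x)
      hfi.integrableOn hx
    rw [gaussQ, hs3, ← this, mul_sub, hC]
    ring
  have hd : ∀ y, HasDerivAt g (s / 2 * f y - s / 2 * ((1 + s * y) * E y)) y := by
    intro y
    have h1 : HasDerivAt (fun y => ∫ u in (0:ℝ)..y, f u) (f y) y :=
      intervalIntegral.integral_hasDerivAt_right (hfc.intervalIntegrable _ _)
        (hfc.stronglyMeasurableAtFilter _ _) hfc.continuousAt
    have h2 : HasDerivAt (fun y => -y ^ 2 / π - s * y) (-(2 * y) / π - s) y := by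
      refine (((((hasDerivAt_id' y).pow 2).neg).div_const π).sub
        ((hasDerivAt_id' y).const_mul s)).congr_deriv ?_
      simp
    have h3 := (h2.exp.const_mul (1/2)).sub ((h1.const_mul (s/2)).const_sub (1/2))
    refine h3.congr_deriv ?_
    have : (2:ℝ) * y / π = s ^ 2 * y := by rw [hs2]; ring
    simp only [hE]
    rw [neg_div π (2 * y), this]
    ring
  have hgc : Continuous g := continuous_iff_continuousAt.2 fun y => (hd y).continuousAt
  set c : ℝ := (π - 2) / 4 with hc
  have hc0 : 0 < c := by have := Real.pi_gt_three; rw [hc]; linarith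
  have hc1 : 2 * c < 1 := by have := Real.pi_lt_d2; rw [hc]; linarith
  set H : ℝ → ℝ := fun t => t - c * t ^ 2 - Real.log (1 + t) with hH
  have hfE : ∀ y, 0 ≤ y → f y = Real.exp (H (s * y)) * ((1 + s * y) * E y) := by
    intro y hy
    have h1 : 0 < 1 + s * y := by positivity
    conv_rhs => rw [← Real.exp_log h1]
    simp only [hE, hf, hH]
    rw [Real.exp_log h1]
    nth_rewrite 2 [← Real.exp_log h1]
    rw [← Real.exp_add, ← Real.exp_add]
    congr 1
    rw [mul_pow, hs2, hc]
    field_simp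
    ring
  rw [hQ]
  suffices 0 ≤ g x by
    have h' : g x = 1 / 2 * E x - (1 / 2 - s / 2 * ∫ u in (0:ℝ)..x, f u) := rfl
    change _ ≤ 1 / 2 * E x
    linarith
  rcases le_or_gt 0 (H (s * x)) with hpos | hneg
  · have mono : MonotoneOn g (Set.Icc 0 x) := by
      apply monotoneOn_of_hasDerivWithinAt_nonneg (convex_Icc _ _) hgc.continuousOn
        (fun y _ => (hd y).hasDerivWithinAt)
      intro y hy
      rw [interior_Icc] at hy
      have hy0 := hy.1
      have : 0 ≤ H (s * y) := shape_aux c hc0 hc1 (by positivity)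
        (mul_le_mul_of_nonneg_left hy.2.le hs0.le) hpos
      rw [hfE y hy0.le, ← mul_sub]
      have h1 := Real.one_le_exp this
      have h2 : 0 < (1 + s * y) * E y := by positivity
      have : 0 ≤ Real.exp (H (s * y)) * ((1 + s * y) * E y) - ((1 + s * y) * E y) := by nlinarith
      positivity
    have := mono ⟨le_rfl, hx⟩ ⟨hx, le_rfl⟩ hx
    have h0 : g 0 = 0 := by simp [hg, hE]
    linarith
  · have anti : AntitoneOn g (Set.Ici x) := by
      apply antitoneOn_of_hasDerivWithinAt_nonpos (convex_Ici _) hgc.continuousOn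
        (fun y _ => (hd y).hasDerivWithinAt)
      intro y hy
      rw [interior_Ici] at hy
      have hxy : x < y := hy
      have hy0 : 0 ≤ y := by linarith
      have : H (s * y) ≤ 0 := by
        by_contra! hcon
        exact absurd (shape_aux c hc0 hc1 (by positivity)
          (mul_le_mul_of_nonneg_left hxy.le hs0.le) hcon.le) (not_le.2 hneg)
      rw [hfE y hy0, ← mul_sub]
      have h1 := Real.exp_le_one_iff.2 this
      have h2 : 0 < (1 + s * y) * E y := by positivity
      exact mul_nonpos_of_nonneg_of_nonpos (by positivity) (by nlinarith)
    have hEt : Filter.Tendsto E Filter.atTop (nhds 0) := by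
      refine squeeze_zero' (g := fun y => Real.exp (-(s * y)))
        (Filter.Eventually.of_forall fun y => (Real.exp_pos _).le)
        (Filter.Eventually.of_forall fun y => ?_) ?_
      · apply Real.exp_le_exp.2
        have : 0 ≤ y ^ 2 / π := by positivity
        rw [neg_div]
        linarith
      · exact Real.tendsto_exp_neg_atTop_nhds_zero.comp
          (Filter.tendsto_id.const_mul_atTop hs0)
    have hlim : Filter.Tendsto g Filter.atTop (nhds 0) := by
      have h1 := intervalIntegral_tendsto_integral_Ioi (f := f) (μ := volume) 0
        hfi.integrableOn Filter.tendsto_id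
      have h2 := (hEt.const_mul (1/2)).sub ((h1.const_mul (s/2)).const_sub (1/2))
      rw [hC] at h2
      simpa [hg] using h2
    refine le_of_tendsto hlim ?_
    filter_upwards [Filter.eventually_ge_atTop x] with y hy
    exact anti (le_refl x : x ≤ x) hy hy
end

section
/- For all real x ≥ 0, Q(x)² + Q(x)·φ(x)·x − φ(x)² ≥ 0, where Q is the Gaussian Q-function and φ the standard normal density. -/
open Real MeasureTheory

lemma gaussQ_aux (x : ℝ) (hx : 0 ≤ x) :
    (Real.sqrt (x ^ 2 + 4) - x) / 2 * Real.exp (-x ^ 2 / 2)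
      ≤ ∫ u in Set.Ioi x, Real.exp (-u ^ 2 / 2) := by
  set G : ℝ → ℝ := fun u => (Real.sqrt (u ^ 2 + 4) - u) / 2 * Real.exp (-u ^ 2 / 2) with hG
  set G' : ℝ → ℝ := fun u => (u / Real.sqrt (u ^ 2 + 4) - 1) / 2 * Real.exp (-u ^ 2 / 2)
    + (Real.sqrt (u ^ 2 + 4) - u) / 2 * (Real.exp (-u ^ 2 / 2) * (-u)) with hG'
  have hs : ∀ u : ℝ, 0 < Real.sqrt (u ^ 2 + 4) ∧ Real.sqrt (u ^ 2 + 4) ^ 2 = u ^ 2 + 4 ∧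
      u < Real.sqrt (u ^ 2 + 4) := by
    intro u
    refine ⟨Real.sqrt_pos.2 (by positivity), Real.sq_sqrt (by positivity), ?_⟩
    apply Real.lt_sqrt_of_sq_lt
    linarith
  have hd : ∀ u, HasDerivAt G (G' u) u := by
    intro u
    have h1 : HasDerivAt (fun u : ℝ => u ^ 2 + 4) (2 * u) u := by
      simpa using (hasDerivAt_pow 2 u).add_const (4 : ℝ)
    have h2 := h1.sqrt (by positivity)
    have h3 : HasDerivAt (fun u : ℝ => -u ^ 2 / 2) (-u) u := by
      have := ((hasDerivAt_pow 2 u).neg).div_const (2 : ℝ)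
      refine this.congr_deriv ?_
      simp; ring
    have h4 := ((h2.sub (hasDerivAt_id u)).div_const 2).mul h3.exp
    refine h4.congr_deriv ?_
    simp only [hG', id, Pi.sub_apply]
    rw [mul_div_mul_left _ _ (two_ne_zero)]
  have hneg : ∀ u ∈ Set.Ioi x, G' u ≤ 0 := by
    intro u hu
    have hu0 : 0 ≤ u := hx.trans (le_of_lt hu)
    obtain ⟨a, b, c⟩ := hs u
    have h1 : u / Real.sqrt (u ^ 2 + 4) ≤ 1 := (div_le_one a).2 c.le
    have e := Real.exp_pos (-u ^ 2 / 2)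
    have h2 : (1 - u / Real.sqrt (u ^ 2 + 4)) * Real.exp (-u ^ 2 / 2) ≥ 0 :=
      mul_nonneg (by linarith) e.le
    have h3 : (Real.sqrt (u ^ 2 + 4) - u) * (Real.exp (-u ^ 2 / 2) * u) ≥ 0 :=
      mul_nonneg (by linarith) (by positivity)
    simp only [hG']
    nlinarith
  have hle : ∀ u, - G' u ≤ Real.exp (-u ^ 2 / 2) := by
    intro u
    obtain ⟨a, b, c⟩ := hs u
    simp only [hG']
    set s := Real.sqrt (u ^ 2 + 4)
    have e := Real.exp_pos (-u ^ 2 / 2)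
    have h0 : u * s ≤ u ^ 2 + 2 := by
      refine abs_le_of_sq_le_sq' ?_ (by positivity) |>.2
      rw [mul_pow, b]; nlinarith
    have key : 0 ≤ 1 + (u / s - 1) / 2 - (s - u) / 2 * u := by
      have h : 1 + (u / s - 1) / 2 - (s - u) / 2 * u
          = (s - u) * (u ^ 2 + 2 - u * s) / (4 * s) := by
        rw [eq_div_iff (by positivity)]
        have hq : u / s * s = u := div_mul_cancel₀ _ a.ne'
        linear_combination 2 * hq - u * b
      rw [h]
      exact div_nonneg (mul_nonneg (by linarith) (by linarith)) (by positivity)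
    nlinarith [mul_nonneg key e.le]
  have he : Filter.Tendsto (fun u : ℝ => Real.exp (-u ^ 2 / 2)) Filter.atTop (nhds 0) := by
    apply Real.tendsto_exp_atBot.comp
    have : Filter.Tendsto (fun u : ℝ => u ^ 2 / 2) Filter.atTop Filter.atTop :=
      (Filter.tendsto_pow_atTop two_ne_zero).atTop_div_const two_pos
    refine (Filter.tendsto_neg_atTop_atBot.comp this).congr ?_
    intro u; simp; ring
  have ht : Filter.Tendsto G Filter.atTop (nhds 0) := by
    refine tendsto_of_tendsto_of_tendsto_of_le_of_le' tendsto_const_nhds he ?_ ?_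
    · filter_upwards with u
      obtain ⟨a, b, c⟩ := hs u
      exact mul_nonneg (by linarith) (Real.exp_pos _).le
    · filter_upwards [Filter.eventually_ge_atTop 0] with u hu
      obtain ⟨a, b, c⟩ := hs u
      apply mul_le_of_le_one_left (Real.exp_pos _).le
      nlinarith
  have hc : ContinuousWithinAt G (Set.Ici x) x := (hd x).continuousAt.continuousWithinAt
  have hI := integral_Ioi_of_hasDerivAt_of_nonpos hc (fun u _ => hd u) hneg ht
  have hInt := integrableOn_Ioi_deriv_of_nonpos hc (fun u _ => hd u) hneg ht
  have hE : IntegrableOn (fun u : ℝ => Real.exp (-u ^ 2 / 2)) (Set.Ioi x) := by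
    have := (integrable_exp_neg_mul_sq (b := 1 / 2) (by norm_num)).integrableOn (s := Set.Ioi x)
    refine this.congr_fun (fun u _ => ?_) measurableSet_Ioi
    simp only
    congr 1; ring
  have := setIntegral_mono hInt.neg hE hle
  have h2 : ∫ u in Set.Ioi x, (-G') u = G x := by
    simp only [Pi.neg_apply]
    rw [integral_neg, hI]; ring
  rw [h2] at this
  exact this

theorem gaussQ_quadratic_lower (x : ℝ) (hx : 0 ≤ x) :
    gaussQ x ^ 2 + gaussQ x * gaussPhi x * x - gaussPhi x ^ 2 ≥ 0 := by
  have h := gaussQ_aux x hx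
  unfold gaussQ gaussPhi
  set I := ∫ u in Set.Ioi x, Real.exp (-u ^ 2 / 2)
  set e := Real.exp (-x ^ 2 / 2) with he
  have e0 : 0 < e := Real.exp_pos _
  have b : Real.sqrt (x ^ 2 + 4) ^ 2 = x ^ 2 + 4 := Real.sq_sqrt (by positivity)
  have c : x ≤ Real.sqrt (x ^ 2 + 4) := Real.le_sqrt_of_sq_le (by linarith)
  set s := Real.sqrt (x ^ 2 + 4)
  set k := Real.sqrt (2 * Real.pi)
  have h0 : 0 ≤ (s - x) / 2 * e := mul_nonneg (by linarith) e0.le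
  have h1 : 0 ≤ (I - (s - x) / 2 * e) * (I + (s - x) / 2 * e + e * x) :=
    mul_nonneg (by linarith) (by nlinarith [mul_nonneg e0.le hx])
  have h2 : (I - (s - x) / 2 * e) * (I + (s - x) / 2 * e + e * x) = I ^ 2 + I * e * x - e ^ 2 := by
    linear_combination (-e ^ 2 / 4) * b
  have h3 : (1 / k * I) ^ 2 + 1 / k * I * (e / k) * x - (e / k) ^ 2
      = (1 / k) ^ 2 * (I ^ 2 + I * e * x - e ^ 2) := by ring
  rw [h3, ← h2]
  exact mul_nonneg (sq_nonneg _) h1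
end

section
/- For all real x ≥ 0, (2/π)·Q(x)² + Q(x)·φ(x)·x − φ(x)² ≤ 0, where Q is the Gaussian Q-function and φ the standard normal density. -/
open Real MeasureTheory

open Filter Topology

namespace GQ

lemma integrable_E : Integrable (fun u : ℝ => Real.exp (-u ^ 2 / 2)) := by
  have h := integrable_exp_neg_mul_sq (b := 1/2) (by norm_num)
  refine h.congr (Filter.Eventually.of_forall fun u => ?_)
  show Real.exp _ = Real.exp _
  congr 1; ring

lemma tail_eq (x : ℝ) : ∫ u in Set.Ioi x, Real.exp (-u ^ 2 / 2)
    = Real.sqrt (2 * π) / 2 - ∫ u in (0:ℝ)..x, Real.exp (-u ^ 2 / 2) := by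
  have h0 : ∫ u in Set.Ioi (0:ℝ), Real.exp (-u ^ 2 / 2) = Real.sqrt (2 * π) / 2 := by
    have h := integral_gaussian_Ioi (1/2)
    have e : (π / (1/2)) = 2 * π := by ring
    rw [e] at h
    rw [← h]
    congr 1; ext u; congr 1; ring
  have := intervalIntegral.integral_Ioi_sub_Ioi' (μ := volume) (a := 0) (b := x)
    integrable_E.integrableOn integrable_E.integrableOn
  rw [h0] at this
  linarith

lemma tail_deriv (x : ℝ) : HasDerivAt (fun x => ∫ u in Set.Ioi x, Real.exp (-u ^ 2 / 2))
    (-Real.exp (-x ^ 2 / 2)) x := by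
  have hc : Continuous (fun u : ℝ => Real.exp (-u ^ 2 / 2)) := by fun_prop
  have h := (hc.integral_hasStrictDerivAt 0 x).hasDerivAt
  have h2 := h.const_sub (Real.sqrt (2 * π) / 2)
  exact h2.congr_of_eventuallyEq (Filter.Eventually.of_forall fun y => tail_eq y)

lemma tail_tendsto : Tendsto (fun x : ℝ => ∫ u in Set.Ioi x, Real.exp (-u ^ 2 / 2)) atTop (𝓝 0) := by
  have h := intervalIntegral_tendsto_integral_Ioi (μ := volume) (0:ℝ)
    integrable_E.integrableOn tendsto_id
  have h2 := h.const_sub (Real.sqrt (2 * π) / 2)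
  have e := tail_eq 0
  rw [intervalIntegral.integral_same, sub_zero] at e
  rw [e, sub_self] at h2
  exact h2.congr fun y => (tail_eq y).symm

noncomputable def D (b x : ℝ) : ℝ := Real.exp (-x ^ 2 / 2) * ((Real.sqrt (x ^ 2 + b) - x) * (2 / b))
  - ∫ u in Set.Ioi x, Real.exp (-u ^ 2 / 2)

lemma D_deriv (b x : ℝ) (hb : 0 < b) : HasDerivAt (D b)
    (Real.exp (-x ^ 2 / 2) * (Real.sqrt (x ^ 2 + b) - x) / (Real.sqrt (x ^ 2 + b) * b)
      * (x ^ 2 + (b - 2) - x * Real.sqrt (x ^ 2 + b))) x := by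
  have hp : 0 < x ^ 2 + b := by positivity
  have h1 : HasDerivAt (fun x : ℝ => -x ^ 2 / 2) (-x) x := by
    have := ((hasDerivAt_pow 2 x).neg).div_const 2
    refine HasDerivAt.congr_deriv this ?_
    norm_num
    ring
  have h2 : HasDerivAt (fun x : ℝ => x ^ 2 + b) (2 * x) x := by
    simpa using (hasDerivAt_pow 2 x).add_const b
  have h3 := h2.sqrt hp.ne'
  have h4 := ((h1.exp).mul ((h3.sub (hasDerivAt_id x)).mul_const (2 / b))).sub (tail_deriv x)
  refine HasDerivAt.congr_deriv h4 ?_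
  have hs : 0 < Real.sqrt (x ^ 2 + b) := Real.sqrt_pos.2 hp
  have hq : Real.sqrt (x ^ 2 + b) ^ 2 = x ^ 2 + b := Real.sq_sqrt hp.le
  simp only [Pi.sub_apply, id]
  generalize Real.sqrt (x ^ 2 + b) = s at *
  obtain rfl : b = s ^ 2 - x ^ 2 := by linarith
  field_simp
  ring

lemma g_nonneg (b x : ℝ) (hb : 0 < b) : 0 < Real.sqrt (x ^ 2 + b) - x := by
  have := Real.lt_sqrt_of_sq_lt (show x ^ 2 < x ^ 2 + b by linarith)
  linarith

lemma D_zero : D (8 / π) 0 = 0 := by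
  unfold D
  rw [tail_eq, intervalIntegral.integral_same]
  have hpi := Real.pi_pos
  have : Real.sqrt (8 / π) * (2 / (8 / π)) = Real.sqrt (2 * π) / 2 := by
    have e : 8 / π = (2 / π) ^ 2 * (2 * π) := by field_simp; norm_num
    have e2 : Real.sqrt (8 / π) = 2 / π * Real.sqrt (2 * π) := by
      rw [e, Real.sqrt_mul (by positivity), Real.sqrt_sq (by positivity)]
    rw [e2]; field_simp; norm_num
  have e0 : (0:ℝ) ^ 2 + 8 / π = 8 / π := by ring
  have e1 : -(0:ℝ) ^ 2 / 2 = 0 := by norm_num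
  rw [e0, e1, Real.exp_zero, sub_zero, this]
  ring

lemma D_tendsto (b : ℝ) (hb : 0 < b) : Tendsto (D b) atTop (𝓝 0) := by
  have hE : Tendsto (fun x : ℝ => Real.exp (-x ^ 2 / 2)) atTop (𝓝 0) := by
    apply Real.tendsto_exp_atBot.comp
    have : Tendsto (fun x : ℝ => x ^ 2 / 2) atTop atTop :=
      (tendsto_pow_atTop two_ne_zero).atTop_div_const two_pos
    exact (tendsto_neg_atTop_atBot.comp this).congr fun x => by simp [neg_div]
  have h1 : Tendsto (fun x : ℝ => Real.exp (-x ^ 2 / 2) *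
      ((Real.sqrt (x ^ 2 + b) - x) * (2 / b))) atTop (𝓝 0) := by
    have hu := hE.mul_const (Real.sqrt b * (2 / b))
    rw [zero_mul] at hu
    refine tendsto_of_tendsto_of_tendsto_of_le_of_le' tendsto_const_nhds hu ?_ ?_
    · refine Filter.Eventually.of_forall fun x => ?_
      have := (g_nonneg b x hb).le
      positivity
    · filter_upwards [eventually_ge_atTop 0] with x hx
      have : Real.sqrt (x ^ 2 + b) - x ≤ Real.sqrt b := by
        have : Real.sqrt (x ^ 2 + b) ≤ x + Real.sqrt b := by
          apply Real.sqrt_le_iff.2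
          refine ⟨by positivity, ?_⟩
          nlinarith [Real.sq_sqrt hb.le, mul_nonneg hx (Real.sqrt_nonneg b)]
        linarith
      gcongr
  have h2 := h1.sub tail_tendsto
  rw [sub_zero] at h2
  exact h2

lemma D_nonneg (x : ℝ) (hx : 0 ≤ x) : 0 ≤ D (8 / π) x := by
  have hpi := Real.pi_pos
  have hb2 : 2 < 8 / π := by
    rw [lt_div_iff₀ hpi]; linarith [Real.pi_lt_d2]
  have hb4 : 8 / π < 4 := by
    rw [div_lt_iff₀ hpi]; linarith [Real.pi_gt_three]
  have hz := D_zero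
  generalize 8 / π = b at *
  have hb : 0 < b := by linarith
  have hd : Differentiable ℝ (D b) := fun y => (D_deriv b y hb).differentiableAt
  have hfac : ∀ y : ℝ, 0 ≤ Real.exp (-y ^ 2 / 2) * (Real.sqrt (y ^ 2 + b) - y) /
      (Real.sqrt (y ^ 2 + b) * b) := fun y => by
    have := (g_nonneg b y hb).le
    positivity
  by_cases hc : x ^ 2 * (4 - b) ≤ (b - 2) ^ 2
  · have hm : MonotoneOn (D b) (Set.Icc 0 x) := by
      apply monotoneOn_of_deriv_nonneg (convex_Icc 0 x) hd.continuous.continuousOn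
        hd.differentiableOn
      intro y hy
      rw [interior_Icc] at hy
      rw [(D_deriv b y hb).deriv]
      refine mul_nonneg (hfac y) ?_
      have hyx : y ^ 2 ≤ x ^ 2 := by nlinarith [hy.1, hy.2]
      have : y * Real.sqrt (y ^ 2 + b) ≤ y ^ 2 + (b - 2) := by
        apply abs_le_of_sq_le_sq' _ (by nlinarith [sq_nonneg y]) |>.2
        rw [mul_pow, Real.sq_sqrt (by positivity)]
        nlinarith
      linarith
    have := hm (Set.left_mem_Icc.2 hx) (Set.right_mem_Icc.2 hx) hx
    rwa [hz] at this
  · push Not at hc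
    have hm : AntitoneOn (D b) (Set.Ici x) := by
      apply antitoneOn_of_deriv_nonpos (convex_Ici x) hd.continuous.continuousOn
        hd.differentiableOn
      intro y hy
      rw [interior_Ici] at hy
      rw [(D_deriv b y hb).deriv]
      refine mul_nonpos_of_nonneg_of_nonpos (hfac y) ?_
      have hy' : x < y := hy
      have hy0 : 0 < y := by linarith
      have hyx : x ^ 2 ≤ y ^ 2 := by nlinarith
      have : y ^ 2 + (b - 2) ≤ y * Real.sqrt (y ^ 2 + b) := by
        apply abs_le_of_sq_le_sq' _ (by positivity) |>.2
        rw [mul_pow, Real.sq_sqrt (by positivity)]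
        nlinarith
      linarith
    refine le_of_tendsto (D_tendsto b hb) ?_
    filter_upwards [eventually_ge_atTop x] with y hy
    exact hm Set.self_mem_Ici hy hy

end GQ

theorem gaussQ_quadratic_upper (x : ℝ) (hx : 0 ≤ x) :
    (2 / Real.pi) * gaussQ x ^ 2 + gaussQ x * gaussPhi x * x - gaussPhi x ^ 2 ≤ 0 := by
  have hD := GQ.D_nonneg x hx
  have hpi := Real.pi_pos
  unfold GQ.D at hD
  unfold gaussQ gaussPhi
  have hI : 0 ≤ ∫ u in Set.Ioi x, Real.exp (-u ^ 2 / 2) :=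
    integral_nonneg fun u => (Real.exp_pos _).le
  have hE : 0 < Real.exp (-x ^ 2 / 2) := Real.exp_pos _
  have hq : Real.sqrt (x ^ 2 + 8 / π) ^ 2 = x ^ 2 + 8 / π := Real.sq_sqrt (by positivity)
  generalize (∫ u in Set.Ioi x, Real.exp (-u ^ 2 / 2)) = I at *
  generalize Real.exp (-x ^ 2 / 2) = E at *
  generalize Real.sqrt (x ^ 2 + 8 / π) = s at *
  obtain ⟨t, ht⟩ : ∃ t, t = E * ((s - x) * (2 / (8 / π))) := ⟨_, rfl⟩
  rw [← ht] at hD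
  have hIt : I ≤ t := by linarith
  have key : (2 / π) * t ^ 2 + t * E * x - E ^ 2 = 0 := by
    have hs : π * s ^ 2 = π * x ^ 2 + 8 := by rw [hq]; field_simp
    rw [ht]; field_simp
    linear_combination (8 * E ^ 2) * hs
  have h1 : (2 / π) * I ^ 2 ≤ (2 / π) * t ^ 2 := by gcongr
  have h2 : I * E * x ≤ t * E * x := by gcongr
  have e : (2 / π) * (1 / Real.sqrt (2 * π) * I) ^ 2
      + (1 / Real.sqrt (2 * π) * I) * (E / Real.sqrt (2 * π)) * x - (E / Real.sqrt (2 * π)) ^ 2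
      = (1 / Real.sqrt (2 * π)) ^ 2 * ((2 / π) * I ^ 2 + I * E * x - E ^ 2) := by ring
  rw [e]
  exact mul_nonpos_of_nonneg_of_nonpos (by positivity) (by linarith)
end

section
/- For all real x ≥ 0, the second derivative of the function L(x) = log(Q(x)) satisfies L''(x) ≥ −1, where Q is the Gaussian Q-function. -/
open Real MeasureTheory

lemma gq_int : Integrable (fun u : ℝ => Real.exp (-u ^ 2 / 2)) := by
  have := integrable_exp_neg_mul_sq (b := 1/2) (by norm_num)
  refine this.congr (Filter.Eventually.of_forall fun u => ?_)
  simp only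
  congr 1
  ring

lemma gq_eq (y : ℝ) : (∫ u in Set.Ioi y, Real.exp (-u ^ 2 / 2)) =
    (∫ u in Set.Ioi (0:ℝ), Real.exp (-u ^ 2 / 2)) - ∫ u in (0:ℝ)..y, Real.exp (-u ^ 2 / 2) := by
  have := intervalIntegral.integral_interval_add_Ioi (a := 0) (b := y)
    gq_int.integrableOn gq_int.integrableOn
  linarith

lemma gq_deriv (y : ℝ) : HasDerivAt (fun y : ℝ => ∫ u in Set.Ioi y, Real.exp (-u ^ 2 / 2))
    (-Real.exp (-y ^ 2 / 2)) y := by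
  have hc : Continuous (fun u : ℝ => Real.exp (-u ^ 2 / 2)) := by fun_prop
  have h := (hc.integral_hasStrictDerivAt 0 y).hasDerivAt
  have h2 := h.const_sub (∫ u in Set.Ioi (0:ℝ), Real.exp (-u ^ 2 / 2))
  rw [funext gq_eq]
  exact h2

lemma gq_tendsto : Filter.Tendsto (fun y : ℝ => ∫ u in Set.Ioi y, Real.exp (-u ^ 2 / 2))
    Filter.atTop (nhds 0) := by
  have h := intervalIntegral_tendsto_integral_Ioi (0:ℝ) gq_int.integrableOn Filter.tendsto_id
  have h2 := h.const_sub (∫ u in Set.Ioi (0:ℝ), Real.exp (-u ^ 2 / 2))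
  rw [funext gq_eq]
  simpa using h2

lemma gq_pos (y : ℝ) : 0 < ∫ u in Set.Ioi y, Real.exp (-u ^ 2 / 2) := by
  rw [setIntegral_pos_iff_support_of_nonneg_ae
    (Filter.Eventually.of_forall fun u => (Real.exp_pos _).le) gq_int.integrableOn]
  have : Function.support (fun u : ℝ => Real.exp (-u ^ 2 / 2)) = Set.univ := by
    ext u; simp [(Real.exp_pos _).ne']
  simp [this]

lemma gexp_deriv (y : ℝ) : HasDerivAt (fun y : ℝ => Real.exp (-y ^ 2 / 2))
    (-y * Real.exp (-y ^ 2 / 2)) y := by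
  have h : HasDerivAt (fun y : ℝ => -y ^ 2 / 2) (-y) y := by
    have := ((hasDerivAt_pow 2 y).neg).div_const 2
    refine HasDerivAt.congr_deriv (f := fun y : ℝ => -y ^ 2 / 2) this ?_
    norm_num
    ring
  convert h.exp using 1
  ring

lemma gexp_tendsto : Filter.Tendsto (fun y : ℝ => Real.exp (-y ^ 2 / 2))
    Filter.atTop (nhds 0) := by
  have := (rpow_mul_exp_neg_mul_sq_isLittleO_exp_neg (b := 1/2) (by norm_num) 0).trans_tendsto
    (Real.tendsto_exp_neg_atTop_nhds_zero.comp (Filter.tendsto_id.const_mul_atTop (r := 1/2) (by norm_num)) |>.congr fun x => by simp)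
  refine this.congr fun y => ?_
  simp only [Real.rpow_zero, one_mul]
  congr 1
  ring

lemma ygexp_tendsto : Filter.Tendsto (fun y : ℝ => y * Real.exp (-y ^ 2 / 2))
    Filter.atTop (nhds 0) := by
  have := (rpow_mul_exp_neg_mul_sq_isLittleO_exp_neg (b := 1/2) (by norm_num) 1).trans_tendsto
    (Real.tendsto_exp_neg_atTop_nhds_zero.comp (Filter.tendsto_id.const_mul_atTop (r := 1/2) (by norm_num)) |>.congr fun x => by simp)
  refine this.congr fun y => ?_
  simp only [Real.rpow_one]
  congr 2
  ring

lemma gq_key (x h : ℝ) : -(x * Real.exp (-x ^ 2 / 2)) + 2 * h * Real.exp (-x ^ 2 / 2)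
    - (1 + h ^ 2) * (∫ u in Set.Ioi x, Real.exp (-u ^ 2 / 2)) ≤ 0 := by
  have hd : ∀ y : ℝ, HasDerivAt (fun x : ℝ => -(x * Real.exp (-x ^ 2 / 2))
      + 2 * h * Real.exp (-x ^ 2 / 2)
      - (1 + h ^ 2) * (∫ u in Set.Ioi x, Real.exp (-u ^ 2 / 2)))
      ((y - h) ^ 2 * Real.exp (-y ^ 2 / 2)) y := by
    intro y
    have := ((((hasDerivAt_id y).mul (gexp_deriv y)).neg).add
      ((gexp_deriv y).const_mul (2 * h))).sub ((gq_deriv y).const_mul (1 + h ^ 2))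
    refine HasDerivAt.congr_deriv this ?_
    simp only [id]
    ring
  have hm := monotone_of_hasDerivAt_nonneg hd (fun y => by positivity)
  have ht := ((ygexp_tendsto.neg).add (gexp_tendsto.const_mul (2 * h))).sub
    (gq_tendsto.const_mul (1 + h ^ 2))
  simp only [mul_zero, neg_zero, add_zero, sub_zero] at ht
  exact hm.ge_of_tendsto ht x

theorem second_deriv_log_gaussQ_ge (x : ℝ) (hx : 0 ≤ x) :
    deriv (deriv (fun y : ℝ => Real.log (gaussQ y))) x ≥ -1 := by
  have hc : (0:ℝ) < 1 / Real.sqrt (2 * Real.pi) := by positivity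
  have h1 : deriv (fun y : ℝ => Real.log (gaussQ y)) = fun y =>
      -Real.exp (-y ^ 2 / 2) / ∫ u in Set.Ioi y, Real.exp (-u ^ 2 / 2) := by
    funext y
    have hp := gq_pos y
    have := ((gq_deriv y).const_mul (1 / Real.sqrt (2 * Real.pi))).log (mul_pos hc hp).ne'
    have h2 := this.deriv
    rw [mul_div_mul_left _ _ hc.ne'] at h2
    exact h2
  rw [h1]
  have hp := gq_pos x
  have h2 := ((gexp_deriv x).neg.div (gq_deriv x) hp.ne').deriv
  have h3 := gq_key x (Real.exp (-x ^ 2 / 2) / ∫ u in Set.Ioi x, Real.exp (-u ^ 2 / 2))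
  refine ge_iff_le.2 (le_of_le_of_eq ?_ h2.symm)
  simp only [Pi.neg_apply]
  generalize (∫ u in Set.Ioi x, Real.exp (-u ^ 2 / 2)) = G at *
  generalize Real.exp (-x ^ 2 / 2) = g at *
  rw [le_div_iff₀ (by positivity)]
  have h4 : (-(x * g) + 2 * (g / G) * g - (1 + (g / G) ^ 2) * G) * G
    = -x * g * G + g ^ 2 - G ^ 2 := by
    field_simp
    ring
  have h5 := mul_nonpos_of_nonpos_of_nonneg h3 hp.le
  rw [h4] at h5
  nlinarith
end

section
/- (Mitrinović inequality) For all real x ≥ 0, Q(x) ≤ 2·φ(x)/(x + √(x² + 8/π)), where Q is the Gaussian Q-function and φ the standard normal density. -/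
open Real MeasureTheory

lemma gq_I0 : ∫ u in Set.Ioi (0:ℝ), Real.exp (-u ^ 2 / 2) = Real.sqrt (2 * Real.pi) / 2 := by
  have h := integral_gaussian_Ioi (1/2)
  rw [show Real.pi / (1/2) = 2 * Real.pi by ring] at h
  rw [← h]
  congr 1
  ext u
  congr 1; ring

noncomputable def gqG (x : ℝ) : ℝ :=
  2 * Real.exp (-x ^ 2 / 2) / (x + Real.sqrt (x ^ 2 + 8 / Real.pi))
    + (∫ u in (0:ℝ)..x, Real.exp (-u ^ 2 / 2)) - Real.sqrt (2 * Real.pi) / 2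

lemma gq_split (x : ℝ) : ∫ u in Set.Ioi x, Real.exp (-u ^ 2 / 2)
    = Real.sqrt (2 * Real.pi) / 2 - ∫ u in (0:ℝ)..x, Real.exp (-u ^ 2 / 2) := by
  rw [← gq_I0, ← intervalIntegral.integral_Ioi_sub_Ioi' gq_int.integrableOn gq_int.integrableOn]
  ring

lemma gq_s_pos (x : ℝ) : 0 < Real.sqrt (x ^ 2 + 8 / Real.pi) := by
  have := Real.pi_pos
  positivity

lemma gq_deriv_s8 (x : ℝ) (hx : 0 ≤ x) : HasDerivAt gqG
    (Real.exp (-x ^ 2 / 2) * ((8 / Real.pi - 2) * Real.sqrt (x ^ 2 + 8 / Real.pi) - 2 * x) /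
      (Real.sqrt (x ^ 2 + 8 / Real.pi) * (x + Real.sqrt (x ^ 2 + 8 / Real.pi)) ^ 2)) x := by
  have hp := Real.pi_pos
  have hc : 0 < 8 / Real.pi := by positivity
  have hs := gq_s_pos x
  have hs2 : Real.sqrt (x ^ 2 + 8 / Real.pi) ^ 2 = x ^ 2 + 8 / Real.pi :=
    Real.sq_sqrt (by positivity)
  have h1 : HasDerivAt (fun x : ℝ => -x ^ 2 / 2) (-x) x := by
    have := ((hasDerivAt_pow 2 x).neg).div_const 2
    refine this.congr_deriv ?_
    push_cast
    ring
  have h2 : HasDerivAt (fun x : ℝ => x ^ 2 + 8 / Real.pi) (2 * x) x := by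
    have := (hasDerivAt_pow 2 x).add_const (8 / Real.pi)
    refine this.congr_deriv ?_
    push_cast
    ring
  have h3 := h2.sqrt (by positivity)
  have h4 := (h1.exp.const_mul 2).div ((hasDerivAt_id x).add h3) (by
    show x + Real.sqrt (x ^ 2 + 8 / Real.pi) ≠ 0
    positivity)
  have hcont : Continuous (fun u : ℝ => Real.exp (-u ^ 2 / 2)) := by fun_prop
  have h5 := intervalIntegral.integral_hasDerivAt_right (hcont.intervalIntegrable 0 x)
    (hcont.stronglyMeasurableAtFilter _ _) hcont.continuousAt
  have h6 := (h4.add h5).sub_const (Real.sqrt (2 * Real.pi) / 2)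
  refine h6.congr_deriv ?_
  simp only [Pi.add_apply, id]
  generalize Real.sqrt (x ^ 2 + 8 / Real.pi) = s at *
  generalize 8 / Real.pi = c at *
  have hxs : 0 < x + s := by positivity
  obtain rfl : c = s ^ 2 - x ^ 2 := by linarith
  field_simp
  ring

lemma gq_lim : Filter.Tendsto gqG Filter.atTop (nhds 0) := by
  have hI := intervalIntegral_tendsto_integral_Ioi 0 gq_int.integrableOn
    (Filter.tendsto_id (α := ℝ) (x := Filter.atTop))
  rw [gq_I0] at hI
  have hA : Filter.Tendsto (fun x : ℝ =>
      2 * Real.exp (-x ^ 2 / 2) / (x + Real.sqrt (x ^ 2 + 8 / Real.pi)))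
      Filter.atTop (nhds 0) := by
    have hz : Filter.Tendsto (fun x : ℝ => 2 / x) Filter.atTop (nhds 0) :=
      tendsto_const_nhds.div_atTop Filter.tendsto_id
    refine tendsto_of_tendsto_of_tendsto_of_le_of_le' tendsto_const_nhds hz ?_ ?_
    · filter_upwards [Filter.eventually_gt_atTop 0] with x hx
      positivity
    · filter_upwards [Filter.eventually_gt_atTop 0] with x hx
      have hs := gq_s_pos x
      have he : Real.exp (-x ^ 2 / 2) ≤ 1 := Real.exp_le_one_iff.2 (by nlinarith [sq_nonneg x])
      gcongr
      · linarith
      · linarith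
  have := (hA.add hI).sub_const (Real.sqrt (2 * Real.pi) / 2)
  rw [zero_add, sub_self] at this
  exact this

lemma gq_zero : gqG 0 = 0 := by
  have hp := Real.pi_pos
  have h : Real.sqrt (2 * Real.pi) * Real.sqrt (8 / Real.pi) = 4 := by
    rw [← Real.sqrt_mul (by positivity), show 2 * Real.pi * (8 / Real.pi) = 4 ^ 2 by
      field_simp; norm_num]
    exact Real.sqrt_sq (by norm_num)
  have hs : 0 < Real.sqrt (8 / Real.pi) := by positivity
  simp only [gqG, intervalIntegral.integral_same]
  rw [show -(0:ℝ) ^ 2 / 2 = 0 by norm_num, show (0:ℝ) ^ 2 + 8 / Real.pi = 8 / Real.pi by norm_num,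
    Real.exp_zero, zero_add, add_zero, mul_one, sub_eq_zero, div_eq_iff (by positivity)]
  linarith

lemma gq_nonneg (x : ℝ) (hx : 0 ≤ x) : 0 ≤ gqG x := by
  have hp := Real.pi_pos
  have hc2 : 2 < 8 / Real.pi := by
    rw [lt_div_iff₀ hp]; linarith [Real.pi_lt_four]
  have hc4 : 8 / Real.pi < 4 := by
    rw [div_lt_iff₀ hp]; linarith [Real.pi_gt_three]
  have key : ∀ y, 0 ≤ y → ∀ z, y ≤ z →
      0 ≤ (8 / Real.pi - 2) * Real.sqrt (z ^ 2 + 8 / Real.pi) - 2 * z →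
      0 ≤ (8 / Real.pi - 2) * Real.sqrt (y ^ 2 + 8 / Real.pi) - 2 * y := by
    intro y hy z hyz h
    have h1 : Real.sqrt (z ^ 2 + 8 / Real.pi) ^ 2 = z ^ 2 + 8 / Real.pi :=
      Real.sq_sqrt (by positivity)
    have h2 : Real.sqrt (y ^ 2 + 8 / Real.pi) ^ 2 = y ^ 2 + 8 / Real.pi :=
      Real.sq_sqrt (by positivity)
    have hs1 := gq_s_pos z
    have hs2 := gq_s_pos y
    generalize Real.sqrt (z ^ 2 + 8 / Real.pi) = s at *
    generalize Real.sqrt (y ^ 2 + 8 / Real.pi) = t at *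
    generalize 8 / Real.pi = c at *
    have h3 : (2 * z) ^ 2 ≤ ((c - 2) * s) ^ 2 := by
      apply pow_le_pow_left₀ (by linarith); linarith
    have h4 : (2 * y) ^ 2 ≤ ((c - 2) * t) ^ 2 := by
      rw [mul_pow (c - 2), h2]
      rw [mul_pow (c - 2), h1] at h3
      have : 0 ≤ (4 - (c - 2) ^ 2) * (z ^ 2 - y ^ 2) :=
        mul_nonneg (by nlinarith) (by nlinarith)
      nlinarith
    have := abs_le_of_sq_le_sq h4 (mul_nonneg (by linarith) hs2.le)
    linarith [le_abs_self (2 * y)]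
  have hsp := gq_s_pos
  rcases le_total 0 ((8 / Real.pi - 2) * Real.sqrt (x ^ 2 + 8 / Real.pi) - 2 * x) with h | h
  · have hm : MonotoneOn gqG (Set.Icc 0 x) := by
      apply monotoneOn_of_deriv_nonneg (convex_Icc 0 x)
      · intro y hy
        exact (gq_deriv_s8 y hy.1).continuousAt.continuousWithinAt
      · intro y hy
        rw [interior_Icc] at hy
        exact (gq_deriv_s8 y hy.1.le).differentiableAt.differentiableWithinAt
      · intro y hy
        rw [interior_Icc] at hy
        rw [(gq_deriv_s8 y hy.1.le).deriv]
        have := key y hy.1.le x hy.2.le h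
        have := hsp y
        positivity
    have := hm (Set.left_mem_Icc.2 hx) (Set.right_mem_Icc.2 hx) hx
    rwa [gq_zero] at this
  · have hm : AntitoneOn gqG (Set.Ici x) := by
      apply antitoneOn_of_deriv_nonpos (convex_Ici x)
      · intro y hy
        exact (gq_deriv_s8 y (hx.trans hy)).continuousAt.continuousWithinAt
      · intro y hy
        rw [interior_Ici] at hy
        exact (gq_deriv_s8 y (hx.trans (le_of_lt hy))).differentiableAt.differentiableWithinAt
      · intro y hy
        rw [interior_Ici] at hy
        have hxy : x < y := hy
        have hy0 : 0 < y := by linarith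
        rw [(gq_deriv_s8 y hy0.le).deriv]
        have hn : (8 / Real.pi - 2) * Real.sqrt (y ^ 2 + 8 / Real.pi) - 2 * y ≤ 0 := by
          by_contra! hcon
          have h0 := key x hx y hxy.le hcon.le
          have e1 : Real.sqrt (x ^ 2 + 8 / Real.pi) ^ 2 = x ^ 2 + 8 / Real.pi :=
            Real.sq_sqrt (by positivity)
          have e2 : Real.sqrt (y ^ 2 + 8 / Real.pi) ^ 2 = y ^ 2 + 8 / Real.pi :=
            Real.sq_sqrt (by positivity)
          have hs1 := gq_s_pos x
          have hs2 := gq_s_pos y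
          generalize Real.sqrt (x ^ 2 + 8 / Real.pi) = s at *
          generalize Real.sqrt (y ^ 2 + 8 / Real.pi) = t at *
          generalize 8 / Real.pi = c at *
          have e3 : (c - 2) * s = 2 * x := by linarith
          have e4 : (2 * y) ^ 2 < ((c - 2) * t) ^ 2 :=
            pow_lt_pow_left₀ (by linarith) (by linarith) (by norm_num)
          have e5 : ((c - 2) * s) ^ 2 = (2 * x) ^ 2 := by rw [e3]
          rw [mul_pow, e1] at e5
          rw [mul_pow (c - 2), e2] at e4
          have : 0 ≤ (4 - (c - 2) ^ 2) * (y ^ 2 - x ^ 2) :=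
            mul_nonneg (by nlinarith) (by nlinarith)
          nlinarith
        have := hsp y
        apply div_nonpos_of_nonpos_of_nonneg
        · exact mul_nonpos_of_nonneg_of_nonpos (Real.exp_pos _).le hn
        · positivity
    refine le_of_tendsto gq_lim ?_
    filter_upwards [Filter.eventually_ge_atTop x] with y hy
    exact hm Set.self_mem_Ici hy hy

theorem gaussQ_mitrinovic (x : ℝ) (hx : 0 ≤ x) :
    gaussQ x ≤ 2 * gaussPhi x / (x + Real.sqrt (x ^ 2 + 8 / Real.pi)) := by
  have h := gq_nonneg x hx
  have hp := Real.pi_pos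
  have hk : 0 ≤ 1 / Real.sqrt (2 * Real.pi) := by positivity
  unfold gaussQ gaussPhi
  rw [gq_split]
  unfold gqG at h
  calc _ ≤ (1 / Real.sqrt (2 * Real.pi)) *
        (2 * Real.exp (-x ^ 2 / 2) / (x + Real.sqrt (x ^ 2 + 8 / Real.pi))) :=
        mul_le_mul_of_nonneg_left (by linarith) hk
    _ = _ := by ring
end

section
/- For all real x ≥ 0, Q(x) ≥ 2·φ(x)/(x + √(x² + 4)), where Q is the Gaussian Q-function and φ the standard normal density. (This is the lower bound on Mill's ratio used to establish Q(x)² + Q(x)·φ(x)·x − φ(x)² ≥ 0.) -/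
open Real MeasureTheory

theorem gaussQ_mills_lower (x : ℝ) (hx : 0 ≤ x) :
    gaussQ x ≥ 2 * gaussPhi x / (x + Real.sqrt (x ^ 2 + 4)) := by
  have hs0 : ∀ u : ℝ, 0 < Real.sqrt (u ^ 2 + 4) := fun u => Real.sqrt_pos.2 (by positivity)
  have hs2 : ∀ u : ℝ, Real.sqrt (u ^ 2 + 4) ^ 2 = u ^ 2 + 4 := fun u => Real.sq_sqrt (by positivity)
  have hlt : ∀ u : ℝ, u ≤ Real.sqrt (u ^ 2 + 4) := fun u => Real.le_sqrt_of_sq_le (by linarith)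
  have hderiv : ∀ u ∈ Set.Ici x, HasDerivAt
      (fun u : ℝ => (Real.sqrt (u ^ 2 + 4) - u) / 2 * Real.exp (-u ^ 2 / 2))
      (-((Real.sqrt (u ^ 2 + 4) - u) / 2 * (1 / Real.sqrt (u ^ 2 + 4) + u)
        * Real.exp (-u ^ 2 / 2))) u := by
    intro u _
    have h1 : HasDerivAt (fun u : ℝ => u ^ 2 + 4) (2 * u) u := by
      simpa using (hasDerivAt_pow 2 u).add_const 4
    have h2 := h1.sqrt (by positivity)
    have h3 : HasDerivAt (fun u : ℝ => -u ^ 2 / 2) (-u) u := by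
      have := ((hasDerivAt_pow 2 u).neg).div_const 2
      refine HasDerivAt.congr_deriv this ?_
      norm_num
      ring
    have h4 := ((h2.sub (hasDerivAt_id u)).div_const 2).mul h3.exp
    refine h4.congr_deriv ?_
    have := (hs0 u).ne'
    simp only [Pi.sub_apply, id]
    field_simp
    ring
  have hneg : ∀ u ∈ Set.Ioi x, -((Real.sqrt (u ^ 2 + 4) - u) / 2 * (1 / Real.sqrt (u ^ 2 + 4) + u)
        * Real.exp (-u ^ 2 / 2)) ≤ 0 := by
    intro u hu
    have hu0 : 0 ≤ u := hx.trans (le_of_lt hu)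
    have := sub_nonneg.2 (hlt u)
    rw [neg_nonpos]
    positivity
  have hexp : Filter.Tendsto (fun u : ℝ => Real.exp (-u ^ 2 / 2)) Filter.atTop (nhds 0) := by
    refine Real.tendsto_exp_atBot.comp ?_
    have h : Filter.Tendsto (fun u : ℝ => u ^ 2 / 2) Filter.atTop Filter.atTop :=
      (Filter.tendsto_pow_atTop (by norm_num)).atTop_div_const (by norm_num)
    refine (Filter.tendsto_neg_atTop_atBot.comp h).congr (fun u => ?_)
    simp only [Function.comp]
    ring
  have hlim : Filter.Tendsto
      (fun u : ℝ => (Real.sqrt (u ^ 2 + 4) - u) / 2 * Real.exp (-u ^ 2 / 2))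
      Filter.atTop (nhds 0) := by
    refine tendsto_of_tendsto_of_tendsto_of_le_of_le' tendsto_const_nhds hexp ?_ ?_
    · refine Filter.Eventually.of_forall fun u => ?_
      have := sub_nonneg.2 (hlt u)
      positivity
    · filter_upwards [Filter.eventually_ge_atTop 0] with u hu
      have h : Real.sqrt (u ^ 2 + 4) ≤ u + 2 := Real.sqrt_le_iff.2 ⟨by linarith, by nlinarith⟩
      have := Real.exp_pos (-u ^ 2 / 2)
      nlinarith
  have hint := integrableOn_Ioi_deriv_of_nonpos' hderiv hneg hlim
  have hval := integral_Ioi_of_hasDerivAt_of_nonpos' hderiv hneg hlim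
  have hgi : IntegrableOn (fun u : ℝ => Real.exp (-u ^ 2 / 2)) (Set.Ioi x) := by
    have h := (integrable_exp_neg_mul_sq (b := 1 / 2) (by norm_num)).integrableOn (s := Set.Ioi x)
    refine h.congr_fun (fun u _ => ?_) measurableSet_Ioi
    simp only
    congr 1
    ring
  have hmono := setIntegral_mono_on hint.neg hgi measurableSet_Ioi (by
    intro u hu
    have hu0 : 0 ≤ u := hx.trans (le_of_lt hu)
    have hs := hs0 u
    have hq := hs2 u
    simp only [Pi.neg_apply, neg_neg]
    set s := Real.sqrt (u ^ 2 + 4)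
    have hkey : u ^ 3 + 3 * u ≤ s * (1 + u ^ 2) := by
      refine abs_le_of_sq_le_sq ?_ (by positivity) |> (le_abs_self _).trans
      rw [mul_pow, hq]
      nlinarith
    have h1 : (s - u) / 2 * (1 / s + u) ≤ 1 := by
      have : (s - u) / 2 * (1 / s + u) = ((s - u) * (1 + u * s)) / (2 * s) := by
        field_simp
      rw [this, div_le_one (by positivity)]
      have : (s - u) * (1 + u * s) = s - u + u * s ^ 2 - u ^ 2 * s := by ring
      rw [this, hq]
      linarith
    exact mul_le_of_le_one_left (Real.exp_pos _).le h1)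
  simp only [Pi.neg_apply] at hmono
  rw [integral_neg, hval] at hmono
  have hpos : 0 < x + Real.sqrt (x ^ 2 + 4) := by have := hs0 x; positivity
  have heq : 2 * gaussPhi x / (x + Real.sqrt (x ^ 2 + 4)) = (1 / Real.sqrt (2 * Real.pi)) *
      ((Real.sqrt (x ^ 2 + 4) - x) / 2 * Real.exp (-x ^ 2 / 2)) := by
    unfold gaussPhi
    have : (Real.sqrt (x ^ 2 + 4) - x) / 2 = 2 / (x + Real.sqrt (x ^ 2 + 4)) := by
      rw [div_eq_div_iff (by norm_num) hpos.ne']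
      linarith [hs2 x]
    rw [this]
    ring
  rw [heq, gaussQ]
  exact mul_le_mul_of_nonneg_left (by linarith) (by positivity)
end
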